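/- The linear operator field L(x,y,z) = [[x,y,0],[y,x,0],[0,0,z]] on ℝ³ is a Nijenhuis operator; the coefficients of its characteristic polynomial are σ₁ = −2x−z, σ₂ = x²−y²+2xz, σ₃ = −x²z+y²z, and these three polynomials are algebraically independent over ℝ. Consequently the algebra 𝔠₅⁺⊕𝔡 with relations η₁⋆η₁ = η₁, η₁⋆η₂ = η₂, η₂⋆η₁ = η₂, η₂⋆η₂ = η₁, η₃⋆η₃ = η₃ (other products zero) is a differentially non-degenerate LSA. -/

import Mathlib

open Matrix

/-- Components `N^i_{jk}` of the Nijenhuis torsion of a matrix-valued operator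
field `L` on `ℝⁿ` (with `L x i j = L^i_j(x)`). -/
noncomputable def nijTorsion {n : ℕ} (L : (Fin n → ℝ) → Matrix (Fin n) (Fin n) ℝ)
    (x : Fin n → ℝ) (i j k : Fin n) : ℝ :=
  ∑ s : Fin n,
    (L x s j * fderiv ℝ (fun y => L y i k) x (Pi.single s 1)
      - L x s k * fderiv ℝ (fun y => L y i j) x (Pi.single s 1)
      - L x i s * fderiv ℝ (fun y => L y s k) x (Pi.single j 1)
      + L x i s * fderiv ℝ (fun y => L y s j) x (Pi.single k 1))

/-- `L` is a Nijenhuis operator: its Nijenhuis torsion vanishes identically. -/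
def IsNijenhuis {n : ℕ} (L : (Fin n → ℝ) → Matrix (Fin n) (Fin n) ℝ) : Prop :=
  ∀ x i j k, nijTorsion L x i j k = 0

/-- Bilinear product on `ℝⁿ` with structure constants `a i j k`
(`ηᵢ ⋆ ηⱼ = ∑ₖ a i j k • ηₖ`). -/
def mulSC {n : ℕ} (a : Fin n → Fin n → Fin n → ℝ) (ξ η : Fin n → ℝ) : Fin n → ℝ :=
  fun k => ∑ i : Fin n, ∑ j : Fin n, a i j k * ξ i * η j

/-- Left-symmetry: the associator is symmetric in its first two arguments. -/
def IsLSA {n : ℕ} (a : Fin n → Fin n → Fin n → ℝ) : Prop :=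
  ∀ ξ η ζ : Fin n → ℝ,
    mulSC a (mulSC a ξ η) ζ - mulSC a ξ (mulSC a η ζ)
      = mulSC a (mulSC a η ξ) ζ - mulSC a η (mulSC a ξ ζ)

/-- The right-adjoint operator field of the algebra with structure constants `a`:
`(R x) k i = ∑ j, a i j k * x j`, i.e. `(R x).mulVec ξ = ξ ⋆ x`. -/
def rightAdj {n : ℕ} (a : Fin n → Fin n → Fin n → ℝ) (x : Fin n → ℝ) :
    Matrix (Fin n) (Fin n) ℝ :=
  Matrix.of fun k i => ∑ j : Fin n, a i j k * x j

/-- `charCoeff L i` is the coefficient `σ_{i+1}` of `t^(n-1-i)` in the characteristic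
polynomial `χ_{L(x)}(t) = tⁿ + σ₁(x) tⁿ⁻¹ + ⋯ + σₙ(x)` of `L(x)`. -/
noncomputable def charCoeff {n : ℕ} (L : (Fin n → ℝ) → Matrix (Fin n) (Fin n) ℝ)
    (i : Fin n) : (Fin n → ℝ) → ℝ :=
  fun x => (L x).charpoly.coeff (n - 1 - (i : ℕ))

/-- A (structure-constant) algebra is differentially non-degenerate if the coefficients
of the characteristic polynomial of its right-adjoint operator are algebraically
independent over `ℝ` (as elements of the algebra of real-valued functions). -/
def DiffNonDeg {n : ℕ} (a : Fin n → Fin n → Fin n → ℝ) : Prop :=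
  AlgebraicIndependent ℝ (charCoeff (rightAdj a))

/-- Isomorphism of the algebras on `ℝⁿ` with structure constants `a` and `b`. -/
def AlgIsoSC {n : ℕ} (a b : Fin n → Fin n → Fin n → ℝ) : Prop :=
  ∃ φ : (Fin n → ℝ) ≃ₗ[ℝ] (Fin n → ℝ),
    ∀ ξ η : Fin n → ℝ, φ (mulSC a ξ η) = mulSC b (φ ξ) (φ η)

/-- Jacobi matrix of a family of functions `σ` on `ℝⁿ`: `J i j = ∂σᵢ/∂xⱼ`. -/
noncomputable def jacobiMat {n : ℕ} (σ : Fin n → (Fin n → ℝ) → ℝ) (x : Fin n → ℝ) :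
    Matrix (Fin n) (Fin n) ℝ :=
  Matrix.of fun i j => fderiv ℝ (σ i) x (Pi.single j 1)

/-- Companion-type matrix with first column `(-s 0, …, -s (n-1))ᵀ`, ones on the
superdiagonal and zeros elsewhere. -/
def companionS {n : ℕ} (s : Fin n → ℝ) : Matrix (Fin n) (Fin n) ℝ :=
  Matrix.of fun i j => if (j : ℕ) = 0 then -s i else if (j : ℕ) = (i : ℕ) + 1 then 1 else 0

/-- The operator field of the 𝔠₅⁺⊕𝔡. -/
def Lop (x : Fin 3 → ℝ) : Matrix (Fin 3) (Fin 3) ℝ :=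
  Matrix.of ![![x 0, x 1, 0], ![x 1, x 0, 0], ![0, 0, x 2]]

/-- Structure constants of the 𝔠₅⁺⊕𝔡. -/
def sc : Fin 3 → Fin 3 → Fin 3 → ℝ :=
  ![![![1,0,0], ![0,1,0], ![0,0,0]],
    ![![0,1,0], ![1,0,0], ![0,0,0]],
    ![![0,0,0], ![0,0,0], ![0,0,1]]]

theorem eval_esymm_fin_three (y : Fin 3 → ℝ) (i : Fin 3) :
    MvPolynomial.eval y (MvPolynomial.esymm (Fin 3) ℝ ((i : ℕ) + 1)) =
      ![y 0 + y 1 + y 2, y 0 * y 1 + y 0 * y 2 + y 1 * y 2, y 0 * y 1 * y 2] i := by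
  have h₁ : Finset.powersetCard 1 (Finset.univ : Finset (Fin 3)) = {{0}, {1}, {2}} := by decide
  have h₂ : Finset.powersetCard 2 (Finset.univ : Finset (Fin 3)) = {{0, 1}, {0, 2}, {1, 2}} := by
    decide
  have h₃ : Finset.powersetCard 3 (Finset.univ : Finset (Fin 3)) = {{0, 1, 2}} := by decide
  have d₁ : ({0} : Finset (Fin 3)) ∉ ({{1}, {2}} : Finset (Finset (Fin 3))) := by decide
  have d₂ : ({1} : Finset (Fin 3)) ∉ ({{2}} : Finset (Finset (Fin 3))) := by decide
  have d₃ : ({0, 1} : Finset (Fin 3)) ∉ ({{0, 2}, {1, 2}} : Finset (Finset (Fin 3))) := by decide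
  have d₄ : ({0, 2} : Finset (Fin 3)) ∉ ({{1, 2}} : Finset (Finset (Fin 3))) := by decide
  fin_cases i
  · simp [MvPolynomial.esymm, h₁, Finset.sum_insert d₁, Finset.sum_insert d₂, add_assoc]
  · simp [MvPolynomial.esymm, h₂, Finset.sum_insert d₃, Finset.sum_insert d₄, add_assoc]
  · simp [MvPolynomial.esymm, h₃, mul_assoc]

/-- Functions that specialize to the elementary symmetric polynomials in three arbitrary reals
are algebraically independent. -/
theorem algebraicIndependent_of_esymm {X : Type*} (σ : Fin 3 → X → ℝ)
    (h : ∀ y : Fin 3 → ℝ, ∃ x, ∀ i, σ i x =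
      ![y 0 + y 1 + y 2, y 0 * y 1 + y 0 * y 2 + y 1 * y 2, y 0 * y 1 * y 2] i) :
    AlgebraicIndependent ℝ σ := by
  rw [algebraicIndependent_iff]
  intro p hp
  apply MvPolynomial.esymmAlgHom_injective (σ := Fin 3) ℝ (n := 3) (by simp)
  rw [map_zero]
  apply Subtype.ext
  apply MvPolynomial.funext
  intro y
  obtain ⟨x, hx⟩ := h y
  have hp' : MvPolynomial.eval (fun i => σ i x) p = 0 := by
    have := congrArg (Pi.evalAlgHom ℝ (fun _ : X => ℝ) x) hp
    rw [← AlgHom.comp_apply, MvPolynomial.comp_aeval] at this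
    simpa [MvPolynomial.aeval_eq_eval] using this
  rw [MvPolynomial.esymmAlgHom_apply, ← MvPolynomial.coe_aeval_eq_eval,
    RingHom.coe_coe, ← AlgHom.comp_apply, MvPolynomial.comp_aeval]
  simp only [MvPolynomial.aeval_eq_eval, eval_esymm_fin_three, ← hx, hp', ZeroMemClass.coe_zero,
    map_zero]

theorem isNijenhuis_Lop : IsNijenhuis Lop := by
  intro x i j k
  have hd (m : Fin 3) : fderiv ℝ (fun y : Fin 3 → ℝ => y m) x = ContinuousLinearMap.proj m :=
    (ContinuousLinearMap.proj (R := ℝ) (φ := fun _ : Fin 3 => ℝ) m).fderiv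
  fin_cases i <;> fin_cases j <;> fin_cases k <;>
    simp [nijTorsion, Lop, Fin.sum_univ_three, hd, Pi.single_apply]

theorem charpoly_Lop (x : Fin 3 → ℝ) :
    (Lop x).charpoly = Polynomial.X ^ 3 + Polynomial.C (-2 * x 0 - x 2) * Polynomial.X ^ 2
      + Polynomial.C (x 0 ^ 2 - x 1 ^ 2 + 2 * x 0 * x 2) * Polynomial.X
      + Polynomial.C (-(x 0 ^ 2 * x 2) + x 1 ^ 2 * x 2) := by
  have h2 : (2 : Polynomial ℝ) = Polynomial.C 2 := rfl
  simp [Matrix.charpoly, Matrix.charmatrix, Matrix.det_fin_three, Lop]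
  rw [← h2]
  ring

theorem charCoeff_Lop : charCoeff Lop =
    ![(fun x : Fin 3 → ℝ => -2 * x 0 - x 2),
      (fun x : Fin 3 → ℝ => x 0 ^ 2 - x 1 ^ 2 + 2 * x 0 * x 2),
      (fun x : Fin 3 → ℝ => -(x 0 ^ 2 * x 2) + x 1 ^ 2 * x 2)] := by
  funext i x
  rw [charCoeff, charpoly_Lop]
  fin_cases i <;>
    simp [Polynomial.coeff_X, Polynomial.coeff_C, Polynomial.coeff_X_pow, -map_sub, -map_add,
      -map_mul, -map_neg]

theorem algebraicIndependent_charCoeff_Lop : AlgebraicIndependent ℝ (charCoeff Lop) := by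
  rw [charCoeff_Lop]
  refine algebraicIndependent_of_esymm _ fun y =>
    ⟨![-(y 0 + y 1) / 2, (y 0 - y 1) / 2, -y 2], fun i => ?_⟩
  fin_cases i <;> simp <;> ring

theorem rightAdj_sc : rightAdj sc = Lop := by
  funext x
  ext i j
  fin_cases i <;> fin_cases j <;> simp [rightAdj, sc, Lop, Fin.sum_univ_three]

theorem isLSA_sc : IsLSA sc := by
  intro ξ η ζ
  funext k
  fin_cases k <;> simp [mulSC, sc, Fin.sum_univ_three] <;> ring

/-- The operator field is a Nijenhuis operator; the coefficients of its
characteristic polynomial are the stated polynomials, which are algebraically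
independent over `ℝ`; it is the right-adjoint operator of the stated algebra,
which is consequently a differentially non-degenerate LSA. -/
theorem stmt10 :
    IsNijenhuis Lop ∧
    (∀ x : Fin 3 → ℝ, charCoeff Lop 0 x = -2 * x 0 - x 2) ∧
    (∀ x : Fin 3 → ℝ, charCoeff Lop 1 x = x 0 ^ 2 - x 1 ^ 2 + 2 * x 0 * x 2) ∧
    (∀ x : Fin 3 → ℝ, charCoeff Lop 2 x = -(x 0 ^ 2 * x 2) + x 1 ^ 2 * x 2) ∧
    AlgebraicIndependent ℝ
      ![(fun x : Fin 3 → ℝ => -2 * x 0 - x 2),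
        (fun x : Fin 3 → ℝ => x 0 ^ 2 - x 1 ^ 2 + 2 * x 0 * x 2),
        (fun x : Fin 3 → ℝ => -(x 0 ^ 2 * x 2) + x 1 ^ 2 * x 2)] ∧
    rightAdj sc = Lop ∧ IsLSA sc ∧ DiffNonDeg sc := by
  refine ⟨isNijenhuis_Lop, fun x => ?_, fun x => ?_, fun x => ?_, ?_, rightAdj_sc, isLSA_sc, ?_⟩
  · rw [charCoeff_Lop]; rfl
  · rw [charCoeff_Lop]; rfl
  · rw [charCoeff_Lop]; rfl
  · exact charCoeff_Lop ▸ algebraicIndependent_charCoeff_Lop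
  · rw [DiffNonDeg, rightAdj_sc]
    exact algebraicIndependent_charCoeff_Lop
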